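/- Let the multifunction F(x,t) be continuous on ℝ^d×[0,T] with nonempty compact convex values, its support function s(F(x,t),ψ) be differentiable in x, and the function (x,t,ψ) ↦ ∇_x s(F(x,t),ψ) be continuous on ℝ^d×[0,T]×S. Then the penalty term φ(x) = ‖h(x(·),ẋ(·),·)‖_p is correctly defined and finite for every x ∈ W^{1,p}_d(0,T), is Gâteaux differentiable at every x ∈ W^{1,p}_d(0,T) with φ(x) > 0, and its Gâteaux derivative is φ'(x)[v] = φ(x)^{1−p} ∫₀^T h(x(t),ẋ(t),t)^{p−1} ( ⟨ψ*(x,t), v̇(t)⟩ − ⟨∇_x s(F(x(t),t), ψ*(x,t)), v(t)⟩ ) dt for all v ∈ W^{1,p}_d(0,T), where ψ*(x,t) = ψ*(x(t),ẋ(t),t). -/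

import Mathlib

open MeasureTheory Set Filter Topology
open scoped ENNReal NNReal

noncomputable section

/-- `ℝ^n` as a Euclidean space. -/
abbrev Vec (n : ℕ) := EuclideanSpace ℝ (Fin n)

/-- Lebesgue measure restricted to the interval `(0, T]`. -/
noncomputable def muT (T : ℝ) : Measure ℝ := volume.restrict (Set.Ioc 0 T)

/-- Membership in `W^{1,p}_d(0,T)`: `x` is absolutely continuous on `[0,T]` with derivative
`x' ∈ L^p(0,T)`. -/
def InW {d : ℕ} (T p : ℝ) (x x' : ℝ → Vec d) : Prop :=
  IntervalIntegrable x' volume 0 T ∧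
  (∀ t ∈ Set.Icc 0 T, x t = x 0 + ∫ s in (0:ℝ)..t, x' s) ∧
  MemLp x' (ENNReal.ofReal p) (muT T)

/-- The support function `s(Y, ψ) = sup_{y ∈ Y} ⟨y, ψ⟩` of the value `Y = F(x,t)`. -/
noncomputable def suppF {d : ℕ} (F : Vec d → ℝ → Set (Vec d)) (x : Vec d) (t : ℝ)
    (ψ : Vec d) : ℝ :=
  sSup ((fun y => (inner ℝ y ψ : ℝ)) '' F x t)

/-- The function `h(x,z,t) = max_{ψ ∈ S} max{0, ⟨z,ψ⟩ − s(F(x,t),ψ)}` (which equals the distance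
from `z` to `F(x,t)`). -/
noncomputable def hfun {d : ℕ} (F : Vec d → ℝ → Set (Vec d)) (x z : Vec d) (t : ℝ) : ℝ :=
  sSup ((fun ψ => max 0 ((inner ℝ z ψ : ℝ) - suppF F x t ψ)) ''
    Metric.sphere (0 : Vec d) 1)

/-- The penalty term `φ(x) = ‖h(x(·), ẋ(·), ·)‖_p` (with values in `[0,+∞]`). -/
noncomputable def phiDI {d : ℕ} (T p : ℝ) (F : Vec d → ℝ → Set (Vec d))
    (x x' : ℝ → Vec d) : ℝ≥0∞ :=
  eLpNorm (fun t => hfun F (x t) (x' t) t) (ENNReal.ofReal p) (muT T)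

open Classical in
/-- The maximiser `ψ*(x,z,t)` of `ψ ↦ ⟨z,ψ⟩ − s(F(x,t),ψ)` over the unit sphere when
`h(x,z,t) > 0` (where it is unique), and a fixed vector `ψ₀ ∈ S` otherwise. -/
noncomputable def psiStar {d : ℕ} (F : Vec d → ℝ → Set (Vec d)) (ψ₀ : Vec d)
    (x z : Vec d) (t : ℝ) : Vec d :=
  if h : 0 < hfun F x z t ∧ ∃ ψ ∈ Metric.sphere (0 : Vec d) 1,
      (inner ℝ z ψ : ℝ) - suppF F x t ψ = hfun F x z t
  then h.2.choose else ψ₀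

section SupportFunction

variable {d : ℕ} {F : Vec d → ℝ → Set (Vec d)}

theorem suppF_bddAbove {x : Vec d} {t : ℝ} (hc : IsCompact (F x t)) (ψ : Vec d) :
    BddAbove ((fun y => (inner ℝ y ψ : ℝ)) '' F x t) :=
  (hc.image (by fun_prop)).bddAbove

theorem inner_le_suppF {x : Vec d} {t : ℝ} (hc : IsCompact (F x t)) (ψ : Vec d) {y : Vec d}
    (hy : y ∈ F x t) : (inner ℝ y ψ : ℝ) ≤ suppF F x t ψ :=
  le_csSup (suppF_bddAbove hc ψ) (mem_image_of_mem _ hy)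

theorem suppF_le {x : Vec d} {t : ℝ} (hne : (F x t).Nonempty) {ψ : Vec d} {C : ℝ}
    (h : ∀ y ∈ F x t, (inner ℝ y ψ : ℝ) ≤ C) : suppF F x t ψ ≤ C :=
  csSup_le (hne.image _) (by rintro _ ⟨y, hy, rfl⟩; exact h y hy)

theorem suppF_combo_le {x : Vec d} {t : ℝ} (hne : (F x t).Nonempty) (hc : IsCompact (F x t))
    {a b : ℝ} (ha : 0 ≤ a) (hb : 0 ≤ b) (ψ χ : Vec d) :
    suppF F x t (a • ψ + b • χ) ≤ a * suppF F x t ψ + b * suppF F x t χ := by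
  refine suppF_le hne fun y hy => ?_
  rw [inner_add_right, real_inner_smul_right, real_inner_smul_right]
  have h1 := inner_le_suppF hc ψ hy
  have h2 := inner_le_suppF hc χ hy
  gcongr

theorem suppF_le_add {x x' : Vec d} {t t' : ℝ} (hne : (F x t).Nonempty)
    (hc' : IsCompact (F x' t')) {ψ ψ' : Vec d} {B r : ℝ} (hB : ∀ y ∈ F x t, ‖y‖ ≤ B)
    (hr : ∀ y ∈ F x t, ∃ y' ∈ F x' t', dist y y' < r) :
    suppF F x t ψ ≤ suppF F x' t' ψ' + (B * ‖ψ - ψ'‖ + r * ‖ψ'‖) := by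
  refine suppF_le hne fun y hy => ?_
  obtain ⟨y', hy', hyy'⟩ := hr y hy
  have h1 : (inner ℝ y ψ : ℝ) = inner ℝ y (ψ - ψ') + inner ℝ (y - y') ψ' + inner ℝ y' ψ' := by
    rw [inner_sub_right, inner_sub_left]; ring
  have h2 : (inner ℝ y (ψ - ψ') : ℝ) ≤ B * ‖ψ - ψ'‖ :=
    (real_inner_le_norm _ _).trans (by gcongr; exact hB y hy)
  have h3 : (inner ℝ (y - y') ψ' : ℝ) ≤ r * ‖ψ'‖ :=
    (real_inner_le_norm _ _).trans (by gcongr; rw [← dist_eq_norm]; exact hyy'.le)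
  have h4 := inner_le_suppF hc' ψ' hy'
  linarith

theorem suppF_le_add' {x x' : Vec d} {t t' : ℝ} (hne : (F x t).Nonempty)
    (hc' : IsCompact (F x' t')) {ψ ψ' : Vec d} {B r : ℝ} (hB : ∀ y' ∈ F x' t', ‖y'‖ ≤ B)
    (hr : ∀ y ∈ F x t, ∃ y' ∈ F x' t', dist y y' < r) :
    suppF F x t ψ ≤ suppF F x' t' ψ' + (B * ‖ψ - ψ'‖ + r * ‖ψ‖) := by
  refine suppF_le hne fun y hy => ?_
  obtain ⟨y', hy', hyy'⟩ := hr y hy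
  have h1 : (inner ℝ y ψ : ℝ) = inner ℝ (y - y') ψ + inner ℝ y' (ψ - ψ') + inner ℝ y' ψ' := by
    rw [inner_sub_right, inner_sub_left]; ring
  have h2 : (inner ℝ y' (ψ - ψ') : ℝ) ≤ B * ‖ψ - ψ'‖ :=
    (real_inner_le_norm _ _).trans (by gcongr; exact hB y' hy')
  have h3 : (inner ℝ (y - y') ψ : ℝ) ≤ r * ‖ψ‖ :=
    (real_inner_le_norm _ _).trans (by gcongr; rw [← dist_eq_norm]; exact hyy'.le)
  have h4 := inner_le_suppF hc' ψ' hy'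
  linarith

theorem continuous_suppF (hFne : ∀ (x : Vec d) (t : ℝ), (F x t).Nonempty)
    (hFcomp : ∀ (x : Vec d) (t : ℝ), IsCompact (F x t))
    (hFcont : Continuous (fun w : Vec d × ℝ =>
      (⟨⟨F w.1 w.2, hFcomp w.1 w.2⟩, hFne w.1 w.2⟩ : TopologicalSpace.NonemptyCompacts (Vec d)))) :
    Continuous fun w : Vec d × ℝ × Vec d => suppF F w.1 w.2.1 w.2.2 := by
  rw [continuous_iff_continuousAt]
  rintro ⟨x, t, ψ⟩
  obtain ⟨B, hB⟩ := (hFcomp x t).isBounded.exists_norm_le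
  rw [Metric.continuousAt_iff']
  intro ε hε
  obtain ⟨r, hr0, hr⟩ : ∃ r : ℝ, 0 < r ∧ r * ‖ψ‖ < ε := by
    refine ⟨ε / (‖ψ‖ + 1), by positivity, ?_⟩
    rw [div_mul_eq_mul_div, div_lt_iff₀ (by positivity)]
    nlinarith [norm_nonneg ψ]
  have hψ : Tendsto (fun w : Vec d × ℝ × Vec d => B * ‖w.2.2 - ψ‖ + r * ‖w.2.2‖) (𝓝 (x, t, ψ))
      (𝓝 (B * ‖ψ - ψ‖ + r * ‖ψ‖)) := Continuous.tendsto (by fun_prop) (x, t, ψ)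
  rw [sub_self, norm_zero, mul_zero, zero_add] at hψ
  have hcomp : Continuous (fun w : Vec d × ℝ × Vec d =>
      (⟨⟨F w.1 w.2.1, hFcomp w.1 w.2.1⟩, hFne w.1 w.2.1⟩ :
        TopologicalSpace.NonemptyCompacts (Vec d))) :=
    hFcont.comp (g := fun w : Vec d × ℝ =>
      (⟨⟨F w.1 w.2, hFcomp w.1 w.2⟩, hFne w.1 w.2⟩ : TopologicalSpace.NonemptyCompacts (Vec d)))
      (f := fun w : Vec d × ℝ × Vec d => (w.1, w.2.1)) (by fun_prop)
  have hd := Metric.continuousAt_iff'.1 (hcomp.continuousAt (x := (x, t, ψ))) r hr0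
  filter_upwards [hd, hψ.eventually_lt_const hr] with w h1 h2
  have h1' : Metric.hausdorffDist (F w.1 w.2.1) (F x t) < r := by
    rwa [Metric.NonemptyCompacts.dist_eq] at h1
  have hfin : Metric.hausdorffEDist (F w.1 w.2.1) (F x t) ≠ ⊤ :=
    Metric.hausdorffEDist_ne_top_of_nonempty_of_bounded (hFne _ _) (hFne _ _)
      (hFcomp _ _).isBounded (hFcomp _ _).isBounded
  have h4 := suppF_le_add' (ψ := w.2.2) (ψ' := ψ) (hFne w.1 w.2.1) (hFcomp x t) hB
    (fun y hy => Metric.exists_dist_lt_of_hausdorffDist_lt hy h1' hfin)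
  have h5 := suppF_le_add (ψ := ψ) (ψ' := w.2.2) (hFne x t) (hFcomp w.1 w.2.1) hB
    (fun y hy => by
      obtain ⟨y', hy', h⟩ := Metric.exists_dist_lt_of_hausdorffDist_lt' hy h1' hfin
      exact ⟨y', hy', by rwa [dist_comm]⟩)
  rw [norm_sub_rev ψ] at h5
  rw [Real.dist_eq, abs_lt]
  constructor <;> linarith

/-- A positive maximum of `ψ ↦ ⟨z, ψ⟩ - s(F(x,t), ψ)` on the unit sphere is attained only once. -/
theorem eq_of_isMax_inner_sub_suppF {x z : Vec d} {t : ℝ} (hne : (F x t).Nonempty)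
    (hc : IsCompact (F x t)) {m : ℝ} (hm : 0 < m)
    (hmax : ∀ ψ ∈ Metric.sphere (0 : Vec d) 1, (inner ℝ z ψ : ℝ) - suppF F x t ψ ≤ m)
    {ψ χ : Vec d} (hψ : ψ ∈ Metric.sphere (0 : Vec d) 1) (hχ : χ ∈ Metric.sphere (0 : Vec d) 1)
    (hψm : m ≤ (inner ℝ z ψ : ℝ) - suppF F x t ψ) (hχm : m ≤ (inner ℝ z χ : ℝ) - suppF F x t χ) :
    ψ = χ := by
  by_contra hneq
  rw [mem_sphere_zero_iff_norm] at hψ hχ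
  set c : Vec d := (1 / 2 : ℝ) • ψ + (1 / 2 : ℝ) • χ with hcdef
  have hc1 : ‖c‖ < 1 :=
    norm_combo_lt_of_ne hψ.le hχ.le hneq (by norm_num) (by norm_num) (by norm_num)
  have hcm : m ≤ (inner ℝ z c : ℝ) - suppF F x t c := by
    have h := suppF_combo_le hne hc (a := 1 / 2) (b := 1 / 2) (by norm_num) (by norm_num) ψ χ
    rw [← hcdef] at h
    have h' : (inner ℝ z c : ℝ) = 1 / 2 * inner ℝ z ψ + 1 / 2 * inner ℝ z χ := by
      rw [hcdef, inner_add_right, real_inner_smul_right, real_inner_smul_right]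
    linarith
  have hc0 : c ≠ 0 := by
    intro h0
    obtain ⟨y, hy⟩ := hne
    have h := inner_le_suppF hc c hy
    rw [h0, inner_zero_right] at h hcm
    linarith
  have hcn : 0 < ‖c‖ := norm_pos_iff.2 hc0
  have hunit : ‖c‖⁻¹ • c ∈ Metric.sphere (0 : Vec d) 1 := by
    rw [mem_sphere_zero_iff_norm, norm_smul, norm_inv, norm_norm, inv_mul_cancel₀ hcn.ne']
  have h1 := hmax _ hunit
  have h2 := suppF_combo_le hne hc (a := ‖c‖⁻¹) (b := 0) (by positivity) le_rfl c 0
  rw [smul_zero, add_zero, zero_mul, add_zero] at h2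
  rw [real_inner_smul_right] at h1
  have h3 : ‖c‖⁻¹ * m ≤ m := by
    have h4 : ‖c‖⁻¹ * m ≤ ‖c‖⁻¹ * ((inner ℝ z c : ℝ) - suppF F x t c) := by gcongr
    linarith
  rw [inv_mul_le_iff₀ hcn] at h3
  nlinarith

end SupportFunction

section Danskin

/-- Danskin's theorem: a maximum function with a unique maximiser is differentiable. -/
theorem hasDerivAt_iSup_of_unique_max {X : Type*} [TopologicalSpace X] [CompactSpace X]
    {f f' : ℝ → X → ℝ} (hf : Continuous fun w : ℝ × X => f w.1 w.2)
    (hf' : Continuous fun w : ℝ × X => f' w.1 w.2)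
    (hder : ∀ ψ a, HasDerivAt (fun b => f b ψ) (f' a ψ) a) {a₀ : ℝ} {ψ₀ : X}
    (hmax : ∀ ψ, f a₀ ψ ≤ f a₀ ψ₀) (huniq : ∀ ψ, f a₀ ψ₀ ≤ f a₀ ψ → ψ = ψ₀) :
    HasDerivAt (fun a => ⨆ ψ, f a ψ) (f' a₀ ψ₀) a₀ := by
  have hne : Nonempty X := ⟨ψ₀⟩
  have hfa : ∀ a, Continuous (f a) := fun a => hf.comp (f := fun ψ => (a, ψ)) (by fun_prop)
  have hbdd : ∀ a, BddAbove (range (f a)) := fun a => (isCompact_range (hfa a)).bddAbove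
  have hexists : ∀ a, ∃ ψ, ∀ χ, f a χ ≤ f a ψ := fun a => by
    obtain ⟨ψ, -, hψ⟩ := isCompact_univ.exists_isMaxOn univ_nonempty (hfa a).continuousOn
    exact ⟨ψ, fun χ => hψ (mem_univ χ)⟩
  choose ψm hψm using hexists
  have hsup : ∀ a, ⨆ ψ, f a ψ = f a (ψm a) := fun a =>
    le_antisymm (ciSup_le (hψm a)) (le_ciSup (hbdd a) _)
  have htend : Tendsto ψm (𝓝 a₀) (𝓝 ψ₀) := by
    refine isCompact_univ.tendsto_nhds_of_unique_mapClusterPt (by simp) fun y _ hy => ?_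
    obtain ⟨U, hU, hUy⟩ := mapClusterPt_iff_ultrafilter.1 hy
    refine huniq y (le_of_tendsto_of_tendsto' (b := (U : Filter ℝ)) (f := fun a => f a ψ₀)
      (g := fun a => f a (ψm a)) ?_ ?_ fun a => hψm a ψ₀)
    · exact ((hder ψ₀ a₀).continuousAt.tendsto).mono_left hU
    · exact (hf.tendsto (a₀, y)).comp (Tendsto.prodMk_nhds (show Tendsto id _ _ from hU) hUy)
  rw [hasDerivAt_iff_isLittleO, Asymptotics.isLittleO_iff]
  intro ε hε
  have hnear : ∀ᶠ w : ℝ × X in 𝓝 (a₀, ψ₀), ‖f' w.1 w.2 - f' a₀ ψ₀‖ < ε := by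
    have := Metric.continuousAt_iff'.1 (hf'.continuousAt (x := (a₀, ψ₀))) ε hε
    simpa [dist_eq_norm] using this
  rw [nhds_prod_eq] at hnear
  obtain ⟨P, hP, Q, hQ, hPQ⟩ := eventually_prod_iff.1 hnear
  obtain ⟨δ, hδ, hPδ⟩ := Metric.eventually_nhds_iff_ball.1 hP
  have key : ∀ ψ, Q ψ → ∀ a ∈ Metric.ball a₀ δ,
      ‖f a ψ - f a₀ ψ - (a - a₀) * f' a₀ ψ₀‖ ≤ ε * ‖a - a₀‖ := by
    intro ψ hψ a ha
    have h := (convex_ball a₀ δ).norm_image_sub_le_of_norm_hasDerivWithin_le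
      (f := fun b => f b ψ - b * f' a₀ ψ₀) (f' := fun b => f' b ψ - f' a₀ ψ₀) (C := ε)
      (fun b _ => by
        simpa using ((hder ψ b).fun_sub
          ((hasDerivAt_id' b).mul_const (f' a₀ ψ₀))).hasDerivWithinAt)
      (fun b hb => (hPQ (hPδ b hb) hψ).le) (Metric.mem_ball_self hδ) ha
    rwa [show f a ψ - a * f' a₀ ψ₀ - (f a₀ ψ - a₀ * f' a₀ ψ₀) =
      f a ψ - f a₀ ψ - (a - a₀) * f' a₀ ψ₀ by ring] at h
  filter_upwards [Metric.ball_mem_nhds a₀ hδ, htend.eventually hQ] with a ha hQa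
  have h1 := key _ hQa a ha
  have h2 := key _ hQ.self_of_nhds a ha
  have e0 : ⨆ ψ, f a₀ ψ = f a₀ ψ₀ := le_antisymm (ciSup_le hmax) (le_ciSup (hbdd a₀) _)
  rw [hsup, e0, smul_eq_mul]
  rw [Real.norm_eq_abs, abs_le] at h1 h2 ⊢
  constructor
  · linarith [hψm a ψ₀]
  · linarith [hmax (ψm a)]

end Danskin

section Distance

variable {d : ℕ} {F : Vec d → ℝ → Set (Vec d)}

theorem bddAbove_hfun
    (hs : Continuous fun w : Vec d × ℝ × Vec d => suppF F w.1 w.2.1 w.2.2) (x z : Vec d) (t : ℝ) :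
    BddAbove ((fun ψ => max 0 ((inner ℝ z ψ : ℝ) - suppF F x t ψ)) ''
      Metric.sphere (0 : Vec d) 1) := by
  have hst : Continuous (suppF F x t) :=
    hs.comp (f := fun ψ : Vec d => (x, t, ψ)) (by fun_prop)
  exact ((isCompact_sphere _ _).image (by fun_prop)).bddAbove

theorem le_hfun (hs : Continuous fun w : Vec d × ℝ × Vec d => suppF F w.1 w.2.1 w.2.2)
    (x z : Vec d) (t : ℝ) {ψ : Vec d} (hψ : ψ ∈ Metric.sphere (0 : Vec d) 1) :
    (inner ℝ z ψ : ℝ) - suppF F x t ψ ≤ hfun F x z t :=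
  (le_max_right _ _).trans (le_csSup (bddAbove_hfun hs x z t) (mem_image_of_mem _ hψ))

theorem hfun_nonneg (x z : Vec d) (t : ℝ) : 0 ≤ hfun F x z t :=
  Real.sSup_nonneg (by rintro _ ⟨ψ, -, rfl⟩; exact le_max_left _ _)

theorem hfun_le (x z : Vec d) (t : ℝ) {C : ℝ} (hC : 0 ≤ C)
    (h : ∀ ψ ∈ Metric.sphere (0 : Vec d) 1, (inner ℝ z ψ : ℝ) - suppF F x t ψ ≤ C) :
    hfun F x z t ≤ C :=
  Real.sSup_le (by rintro _ ⟨ψ, hψ, rfl⟩; exact max_le hC (h ψ hψ)) hC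

theorem continuous_hfun (hs : Continuous fun w : Vec d × ℝ × Vec d => suppF F w.1 w.2.1 w.2.2) :
    Continuous fun w : Vec d × Vec d × ℝ => hfun F w.1 w.2.1 w.2.2 := by
  refine (isCompact_sphere (0 : Vec d) 1).continuous_sSup
    (f := fun (w : Vec d × Vec d × ℝ) ψ => max 0 ((inner ℝ w.2.1 ψ : ℝ) - suppF F w.1 w.2.2 ψ)) ?_
  have h : Continuous fun q : (Vec d × Vec d × ℝ) × Vec d => suppF F q.1.1 q.1.2.2 q.2 :=
    hs.comp (f := fun q : (Vec d × Vec d × ℝ) × Vec d => (q.1.1, q.1.2.2, q.2)) (by fun_prop)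
  simp only [Function.HasUncurry.uncurry, id]
  fun_prop

theorem hfun_eq_max_iSup
    (hs : Continuous fun w : Vec d × ℝ × Vec d => suppF F w.1 w.2.1 w.2.2)
    [Nonempty (Metric.sphere (0 : Vec d) 1)] (x z : Vec d) (t : ℝ) :
    hfun F x z t =
      max 0 (⨆ ψ : Metric.sphere (0 : Vec d) 1, ((inner ℝ z (ψ : Vec d) : ℝ) - suppF F x t ψ)) := by
  have hb : BddAbove (range fun ψ : Metric.sphere (0 : Vec d) 1 =>
      ((inner ℝ z (ψ : Vec d) : ℝ) - suppF F x t ψ)) :=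
    ⟨hfun F x z t, by rintro _ ⟨ψ, rfl⟩; exact le_hfun hs x z t ψ.2⟩
  refine le_antisymm (hfun_le x z t (le_max_left _ _) fun ψ hψ => ?_)
    (max_le (hfun_nonneg x z t) (ciSup_le fun ψ => le_hfun hs x z t ψ.2))
  exact (le_ciSup hb ⟨ψ, hψ⟩).trans (le_max_right _ _)

theorem psiStar_spec (hs : Continuous fun w : Vec d × ℝ × Vec d => suppF F w.1 w.2.1 w.2.2)
    {ψ₀ : Vec d} (hψ₀ : ψ₀ ∈ Metric.sphere (0 : Vec d) 1) {x z : Vec d} {t : ℝ}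
    (hpos : 0 < hfun F x z t) :
    psiStar F ψ₀ x z t ∈ Metric.sphere (0 : Vec d) 1 ∧
      (inner ℝ z (psiStar F ψ₀ x z t) : ℝ) - suppF F x t (psiStar F ψ₀ x z t) = hfun F x z t := by
  have hst : Continuous (suppF F x t) :=
    hs.comp (f := fun ψ : Vec d => (x, t, ψ)) (by fun_prop)
  obtain ⟨ψ, hψ, hmax⟩ := (isCompact_sphere (0 : Vec d) 1).exists_isMaxOn ⟨ψ₀, hψ₀⟩
    (f := fun ψ => (inner ℝ z ψ : ℝ) - suppF F x t ψ) (by fun_prop)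
  have hle : hfun F x z t ≤ max 0 ((inner ℝ z ψ : ℝ) - suppF F x t ψ) :=
    hfun_le x z t (le_max_left _ _) fun χ hχ => (hmax hχ).trans (le_max_right _ _)
  have hatt : (inner ℝ z ψ : ℝ) - suppF F x t ψ = hfun F x z t := by
    refine le_antisymm (le_hfun hs x z t hψ) ?_
    rcases le_max_iff.1 hle with h | h
    · exact absurd hpos h.not_gt
    · exact h
  have hex : 0 < hfun F x z t ∧ ∃ ψ ∈ Metric.sphere (0 : Vec d) 1,
      (inner ℝ z ψ : ℝ) - suppF F x t ψ = hfun F x z t := ⟨hpos, ψ, hψ, hatt⟩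
  rw [psiStar, dif_pos hex]
  exact hex.2.choose_spec

theorem hfun_le_add_of_suppF_lipschitz
    (hs : Continuous fun w : Vec d × ℝ × Vec d => suppF F w.1 w.2.1 w.2.2) {x y z w : Vec d}
    {t L : ℝ} (hL : ∀ ψ ∈ Metric.sphere (0 : Vec d) 1,
      |suppF F x t ψ - suppF F y t ψ| ≤ L * ‖x - y‖) (hL0 : 0 ≤ L) :
    hfun F x z t ≤ hfun F y w t + (‖z - w‖ + L * ‖x - y‖) := by
  refine hfun_le x z t (add_nonneg (hfun_nonneg y w t) (by positivity)) fun ψ hψ => ?_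
  have h1 := le_hfun hs y w t hψ
  have h2 := (abs_le.1 (hL ψ hψ)).1
  have h3 : (inner ℝ z ψ : ℝ) - inner ℝ w ψ ≤ ‖z - w‖ := by
    rw [← inner_sub_left]
    refine (real_inner_le_norm _ _).trans ?_
    rw [mem_sphere_zero_iff_norm.1 hψ, mul_one]
  linarith

theorem abs_hfun_sub_le
    (hs : Continuous fun w : Vec d × ℝ × Vec d => suppF F w.1 w.2.1 w.2.2) {x y z w : Vec d}
    {t L : ℝ} (hL : ∀ ψ ∈ Metric.sphere (0 : Vec d) 1,
      |suppF F x t ψ - suppF F y t ψ| ≤ L * ‖x - y‖) (hL0 : 0 ≤ L) :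
    |hfun F x z t - hfun F y w t| ≤ ‖z - w‖ + L * ‖x - y‖ := by
  have h1 := hfun_le_add_of_suppF_lipschitz hs (z := z) (w := w) hL hL0
  have h2 := hfun_le_add_of_suppF_lipschitz hs (x := y) (y := x) (z := w) (w := z)
    (fun ψ hψ => by rw [abs_sub_comm, norm_sub_rev]; exact hL ψ hψ) hL0
  rw [norm_sub_rev, norm_sub_rev y x] at h2
  rw [abs_le]
  constructor <;> linarith

end Distance

section Gradient

variable {d : ℕ} {T : ℝ} {F : Vec d → ℝ → Set (Vec d)} {sGrad : Vec d → ℝ → Vec d → Vec d}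

theorem exists_suppF_lipschitz
    (hsG : ∀ (t : ℝ), t ∈ Set.Icc 0 T → ∀ ψ ∈ Metric.sphere (0 : Vec d) 1, ∀ x : Vec d,
      HasGradientAt (fun a => suppF F a t ψ) (sGrad x t ψ) x)
    (hsGc : ContinuousOn (fun w : Vec d × ℝ × Vec d => sGrad w.1 w.2.1 w.2.2)
      (Set.univ ×ˢ Set.Icc 0 T ×ˢ Metric.sphere (0 : Vec d) 1)) (R : ℝ) :
    ∃ L : ℝ, 0 ≤ L ∧ ∀ t ∈ Set.Icc 0 T, ∀ ψ ∈ Metric.sphere (0 : Vec d) 1,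
      ∀ x ∈ Metric.closedBall (0 : Vec d) R, ∀ y ∈ Metric.closedBall (0 : Vec d) R,
        |suppF F x t ψ - suppF F y t ψ| ≤ L * ‖x - y‖ := by
  obtain ⟨L, hL⟩ := ((isCompact_closedBall (0 : Vec d) R).prod
    (isCompact_Icc.prod (isCompact_sphere (0 : Vec d) 1))).exists_bound_of_continuousOn
    (hsGc.mono (prod_mono (subset_univ _) le_rfl))
  refine ⟨max L 0, le_max_right _ _, fun t ht ψ hψ x hx y hy => ?_⟩
  refine (convex_closedBall (0 : Vec d) R).norm_image_sub_le_of_norm_hasFDerivWithin_le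
    (f := fun a => suppF F a t ψ) (C := max L 0)
    (fun a _ => (hsG t ht ψ hψ a).hasFDerivAt.hasFDerivWithinAt) (fun a ha => ?_) hy hx
  rw [LinearIsometryEquiv.norm_map]
  exact (hL (a, t, ψ) ⟨ha, ht, hψ⟩).trans (le_max_left _ _)

theorem hasDerivAt_hfun_of_pos (hFne : ∀ (x : Vec d) (t : ℝ), (F x t).Nonempty)
    (hFcomp : ∀ (x : Vec d) (t : ℝ), IsCompact (F x t))
    (hs : Continuous fun w : Vec d × ℝ × Vec d => suppF F w.1 w.2.1 w.2.2)
    (hsG : ∀ (t : ℝ), t ∈ Set.Icc 0 T → ∀ ψ ∈ Metric.sphere (0 : Vec d) 1, ∀ x : Vec d,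
      HasGradientAt (fun a => suppF F a t ψ) (sGrad x t ψ) x)
    (hsGc : ContinuousOn (fun w : Vec d × ℝ × Vec d => sGrad w.1 w.2.1 w.2.2)
      (Set.univ ×ˢ Set.Icc 0 T ×ˢ Metric.sphere (0 : Vec d) 1))
    {ψ₀ : Vec d} (hψ₀ : ψ₀ ∈ Metric.sphere (0 : Vec d) 1) {t : ℝ} (ht : t ∈ Set.Icc 0 T)
    {x z : Vec d} (v w : Vec d) (hpos : 0 < hfun F x z t) :
    HasDerivAt (fun a : ℝ => hfun F (x + a • v) (z + a • w) t)
      ((inner ℝ (psiStar F ψ₀ x z t) w : ℝ) -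
        (inner ℝ (sGrad x t (psiStar F ψ₀ x z t)) v : ℝ)) 0 := by
  have hne : Nonempty (Metric.sphere (0 : Vec d) 1) := ⟨⟨ψ₀, hψ₀⟩⟩
  obtain ⟨hψS, hψeq⟩ := psiStar_spec hs hψ₀ hpos
  set ψs := psiStar F ψ₀ x z t
  have hD := hasDerivAt_iSup_of_unique_max (X := Metric.sphere (0 : Vec d) 1)
    (f := fun a ψ => (inner ℝ (z + a • w) (ψ : Vec d) : ℝ) - suppF F (x + a • v) t ψ)
    (f' := fun a ψ => (inner ℝ (ψ : Vec d) w : ℝ) - inner ℝ (sGrad (x + a • v) t ψ) v)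
    (a₀ := 0) (ψ₀ := ⟨ψs, hψS⟩) ?_ ?_ ?_ ?_ ?_
  · simp only [zero_smul, add_zero] at hD
    have hpos' : (0 : ℝ) < ⨆ ψ : Metric.sphere (0 : Vec d) 1,
        ((inner ℝ (z + (0 : ℝ) • w) (ψ : Vec d) : ℝ) - suppF F (x + (0 : ℝ) • v) t ψ) := by
      have h := hfun_eq_max_iSup hs x z t
      rw [h] at hpos
      simpa using hpos
    refine hD.congr_of_eventuallyEq ?_
    filter_upwards [hD.continuousAt.eventually_const_lt hpos'] with a ha
    rw [hfun_eq_max_iSup hs, max_eq_right ha.le]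
  · have h : Continuous fun q : ℝ × Metric.sphere (0 : Vec d) 1 =>
        suppF F (x + q.1 • v) t (q.2 : Vec d) :=
      hs.comp (f := fun q : ℝ × Metric.sphere (0 : Vec d) 1 =>
        (x + q.1 • v, t, (q.2 : Vec d))) (by fun_prop)
    fun_prop
  · have h : Continuous fun q : ℝ × Metric.sphere (0 : Vec d) 1 =>
        sGrad (x + q.1 • v) t (q.2 : Vec d) :=
      hsGc.comp_continuous (f := fun q : ℝ × Metric.sphere (0 : Vec d) 1 =>
        (x + q.1 • v, t, (q.2 : Vec d))) (by fun_prop) fun q => ⟨mem_univ _, ht, q.2.2⟩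
    exact (Continuous.inner (by fun_prop) continuous_const).sub (h.inner continuous_const)
  · intro ψ a
    have h1 : HasDerivAt (fun b : ℝ => x + b • v) v a := by
      simpa using ((hasDerivAt_id' a).smul_const v).const_add x
    have h2 : HasDerivAt (fun b : ℝ => (inner ℝ (z + b • w) (ψ : Vec d) : ℝ))
        (inner ℝ (ψ : Vec d) w) a := by
      have : HasDerivAt (fun b : ℝ => z + b • w) w a := by
        simpa using ((hasDerivAt_id' a).smul_const w).const_add z
      simpa [real_inner_comm] using this.inner ℝ (hasDerivAt_const a (ψ : Vec d))
    have h3 := (hsG t ht ψ ψ.2 (x + a • v)).hasFDerivAt.comp_hasDerivAt a h1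
    rw [InnerProductSpace.toDual_apply_apply] at h3
    exact h2.sub h3
  · intro ψ
    simp only [zero_smul, add_zero]
    rw [hψeq]
    exact le_hfun hs x z t ψ.2
  · intro ψ h
    simp only [zero_smul, add_zero] at h
    rw [hψeq] at h
    exact Subtype.ext (eq_of_isMax_inner_sub_suppF (hFne x t) (hFcomp x t) hpos
      (fun χ hχ => le_hfun hs x z t hχ) ψ.2 hψS h hψeq.ge)

theorem hasDerivAt_rpow_of_abs_le {g : ℝ → ℝ} {p C a₀ : ℝ} (hp : 1 < p)
    (hg : ∀ᶠ a in 𝓝 a₀, |g a| ≤ C * |a - a₀|) : HasDerivAt (fun a => g a ^ p) 0 a₀ := by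
  have hg0 : g a₀ = 0 := by simpa using hg.self_of_nhds
  have hO : (fun a => g a - g a₀) =O[𝓝 a₀] fun a => a - a₀ :=
    Asymptotics.IsBigO.of_bound C (by simpa [hg0] using hg)
  have hgc : ContinuousAt g a₀ := by
    have h : Tendsto (fun a => g a - g a₀) (𝓝 a₀) (𝓝 0) :=
      hO.trans_tendsto (tendsto_sub_nhds_zero_iff.2 tendsto_id)
    exact tendsto_sub_nhds_zero_iff.1 h
  have h1 : HasDerivAt (fun y : ℝ => y ^ p) 0 (g a₀) := by
    convert Real.hasDerivAt_rpow_const (x := g a₀) (p := p) (Or.inr hp.le) using 1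
    rw [hg0, Real.zero_rpow (by linarith), mul_zero]
  have h2 := (hasDerivAt_iff_isLittleO.1 h1).comp_tendsto hgc.tendsto
  rw [hasDerivAt_iff_isLittleO]
  exact h2.trans_isBigO hO |>.congr_left (by simp)

theorem abs_rpow_sub_rpow_le {p H a b : ℝ} (hp : 1 < p) (ha : a ∈ Icc 0 H) (hb : b ∈ Icc 0 H) :
    |a ^ p - b ^ p| ≤ p * H ^ (p - 1) * |a - b| := by
  refine (convex_Icc 0 H).norm_image_sub_le_of_norm_hasDerivWithin_le
    (f := fun y : ℝ => y ^ p) (f' := fun y => p * y ^ (p - 1))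
    (fun y _ => (Real.hasDerivAt_rpow_const (Or.inr hp.le)).hasDerivWithinAt) (fun y hy => ?_) hb ha
  rw [Real.norm_eq_abs, abs_of_nonneg (mul_nonneg (by linarith) (Real.rpow_nonneg hy.1 _))]
  exact mul_le_mul_of_nonneg_left (Real.rpow_le_rpow hy.1 hy.2 (by linarith)) (by linarith)

end Gradient

section Penalty

variable {d : ℕ} {T p : ℝ} {F : Vec d → ℝ → Set (Vec d)}

instance isFiniteMeasure_muT : IsFiniteMeasure (muT T) :=
  inferInstanceAs (IsFiniteMeasure (volume.restrict (Set.Ioc 0 T)))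

theorem ae_muT_mem : ∀ᵐ t ∂muT T, t ∈ Icc 0 T := by
  filter_upwards [ae_restrict_mem measurableSet_Ioc] with t ht
  exact Ioc_subset_Icc_self ht

theorem InW.continuousOn {x x' : ℝ → Vec d} (hT : 0 < T) (hx : InW T p x x') :
    ContinuousOn x (Icc 0 T) := by
  have h := intervalIntegral.continuousOn_primitive_interval (μ := volume) (f := x')
    (a := 0) (b := T) ((intervalIntegrable_iff' (by simp)).1 hx.1)
  rw [uIcc_of_le hT.le] at h
  exact (continuousOn_const.add h).congr hx.2.1

theorem InW.exists_bound {x x' : ℝ → Vec d} (hT : 0 < T) (hx : InW T p x x') :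
    ∃ M, 0 ≤ M ∧ ∀ t ∈ Icc 0 T, ‖x t‖ ≤ M := by
  obtain ⟨M, hM⟩ := isCompact_Icc.exists_bound_of_continuousOn (hx.continuousOn hT)
  exact ⟨M, (norm_nonneg _).trans (hM 0 ⟨le_rfl, hT.le⟩), hM⟩

theorem InW.aestronglyMeasurable {x x' : ℝ → Vec d} (hT : 0 < T) (hx : InW T p x x') :
    AEStronglyMeasurable x (muT T) :=
  ((hx.continuousOn hT).mono Ioc_subset_Icc_self).aestronglyMeasurable measurableSet_Ioc

theorem InW.add_smul {x x' v v' : ℝ → Vec d} (hT : 0 < T) (hx : InW T p x x')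
    (hv : InW T p v v') (a : ℝ) :
    InW T p (fun t => x t + a • v t) (fun t => x' t + a • v' t) := by
  refine ⟨hx.1.add (hv.1.smul a), fun t ht => ?_, hx.2.2.add (hv.2.2.const_smul a)⟩
  have hsub : uIcc 0 t ⊆ uIcc 0 T := by
    rw [uIcc_of_le ht.1, uIcc_of_le hT.le]
    exact Icc_subset_Icc_right ht.2
  have h1 := hx.1.mono_set hsub
  have h2 : IntervalIntegrable (fun s => a • v' s) volume 0 t := (hv.1.mono_set hsub).smul a
  beta_reduce
  rw [intervalIntegral.integral_add h1 h2, intervalIntegral.integral_smul, hx.2.1 t ht,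
    hv.2.1 t ht]
  module

theorem memLp_hfun (hT : 0 < T)
    (hs : Continuous fun w : Vec d × ℝ × Vec d => suppF F w.1 w.2.1 w.2.2)
    {x x' : ℝ → Vec d} (hx : InW T p x x') :
    MemLp (fun t => hfun F (x t) (x' t) t) (ENNReal.ofReal p) (muT T) := by
  have hmeas : AEStronglyMeasurable (fun t => hfun F (x t) (x' t) t) (muT T) :=
    (continuous_hfun hs).comp_aestronglyMeasurable (f := fun t => (x t, x' t, t))
      ((hx.aestronglyMeasurable hT).prodMk
        (hx.2.2.aestronglyMeasurable.prodMk aestronglyMeasurable_id))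
  obtain ⟨M, -, hM⟩ := hx.exists_bound hT
  obtain ⟨R, hR⟩ := ((isCompact_closedBall (0 : Vec d) M).prod
    ((isCompact_Icc (a := 0) (b := T)).prod
      (isCompact_sphere (0 : Vec d) 1))).exists_bound_of_continuousOn hs.continuousOn
  refine MemLp.of_le (hx.2.2.norm.add (memLp_const (|R|))) hmeas ?_
  filter_upwards [ae_muT_mem] with t ht
  rw [Real.norm_of_nonneg (hfun_nonneg _ _ _)]
  refine (hfun_le _ _ _ (C := ‖x' t‖ + |R|) (by positivity) fun ψ hψ => ?_).trans
    (le_abs_self _)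
  have h1 := hR (x t, t, ψ) ⟨mem_closedBall_zero_iff.2 (hM t ht), ht, hψ⟩
  have h2 := real_inner_le_norm (x' t) ψ
  rw [mem_sphere_zero_iff_norm.1 hψ, mul_one] at h2
  have h3 := (abs_le.1 h1).1
  linarith [le_abs_self R]

theorem integrable_rpow_of_memLp {μ : Measure ℝ} (hp : 1 < p) {g : ℝ → ℝ} (hg0 : ∀ t, 0 ≤ g t)
    (hg : MemLp g (ENNReal.ofReal p) μ) : Integrable (fun t => g t ^ p) μ := by
  have hp0 : 0 < p := by linarith
  have h := hg.integrable_norm_rpow (ENNReal.ofReal_pos.2 hp0).ne' ENNReal.ofReal_ne_top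
  rw [ENNReal.toReal_ofReal hp0.le] at h
  simpa only [Real.norm_of_nonneg (hg0 _)] using h

theorem toReal_phiDI (hT : 0 < T) (hp : 1 < p)
    (hs : Continuous fun w : Vec d × ℝ × Vec d => suppF F w.1 w.2.1 w.2.2)
    {x x' : ℝ → Vec d} (hx : InW T p x x') :
    (phiDI T p F x x').toReal = (∫ t, hfun F (x t) (x' t) t ^ p ∂muT T) ^ p⁻¹ := by
  have hp0 : 0 < p := by linarith
  rw [phiDI, (memLp_hfun hT hs hx).eLpNorm_eq_integral_rpow_norm (ENNReal.ofReal_pos.2 hp0).ne'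
    ENNReal.ofReal_ne_top, ENNReal.toReal_ofReal hp0.le]
  simp only [Real.norm_of_nonneg (hfun_nonneg _ _ _)]
  exact ENNReal.toReal_ofReal (Real.rpow_nonneg
    (integral_nonneg fun t => Real.rpow_nonneg (hfun_nonneg _ _ _) _) _)

theorem hasDerivAt_integral_hfun_rpow (hT : 0 < T) (hp : 1 < p)
    (hFne : ∀ (x : Vec d) (t : ℝ), (F x t).Nonempty)
    (hFcomp : ∀ (x : Vec d) (t : ℝ), IsCompact (F x t))
    (hs : Continuous fun w : Vec d × ℝ × Vec d => suppF F w.1 w.2.1 w.2.2)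
    {sGrad : Vec d → ℝ → Vec d → Vec d}
    (hsG : ∀ (t : ℝ), t ∈ Set.Icc 0 T → ∀ ψ ∈ Metric.sphere (0 : Vec d) 1, ∀ x : Vec d,
      HasGradientAt (fun a => suppF F a t ψ) (sGrad x t ψ) x)
    (hsGc : ContinuousOn (fun w : Vec d × ℝ × Vec d => sGrad w.1 w.2.1 w.2.2)
      (Set.univ ×ˢ Set.Icc 0 T ×ˢ Metric.sphere (0 : Vec d) 1))
    {ψ₀ : Vec d} (hψ₀ : ψ₀ ∈ Metric.sphere (0 : Vec d) 1) {x x' v v' : ℝ → Vec d}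
    (hx : InW T p x x') (hv : InW T p v v') :
    HasDerivAt (fun a : ℝ => ∫ t, hfun F (x t + a • v t) (x' t + a • v' t) t ^ p ∂muT T)
      (∫ t, p * (hfun F (x t) (x' t) t ^ (p - 1) *
        ((inner ℝ (psiStar F ψ₀ (x t) (x' t) t) (v' t) : ℝ) -
          (inner ℝ (sGrad (x t) t (psiStar F ψ₀ (x t) (x' t) t)) (v t) : ℝ))) ∂muT T) 0 := by
  obtain ⟨M, hM0, hM⟩ := hx.exists_bound hT
  obtain ⟨N, hN0, hN⟩ := hv.exists_bound hT
  obtain ⟨L, hL0, hL⟩ := exists_suppF_lipschitz hsG hsGc (M + N)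
  have hball : ∀ t ∈ Icc 0 T, ∀ a ∈ Metric.ball (0 : ℝ) 1,
      x t + a • v t ∈ Metric.closedBall (0 : Vec d) (M + N) := by
    intro t ht a ha
    rw [mem_closedBall_zero_iff]
    rw [mem_ball_zero_iff] at ha
    refine (norm_add_le _ _).trans (add_le_add (hM t ht) ?_)
    rw [norm_smul]
    calc ‖a‖ * ‖v t‖ ≤ 1 * N := by gcongr; exact hN t ht
      _ = N := one_mul N
  have hlip : ∀ t ∈ Icc 0 T, ∀ a ∈ Metric.ball (0 : ℝ) 1, ∀ b ∈ Metric.ball (0 : ℝ) 1,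
      |hfun F (x t + a • v t) (x' t + a • v' t) t - hfun F (x t + b • v t) (x' t + b • v' t) t|
        ≤ (‖v' t‖ + L * N) * |a - b| := by
    intro t ht a ha b hb
    refine (abs_hfun_sub_le hs
      (fun ψ hψ => hL t ht ψ hψ _ (hball t ht a ha) _ (hball t ht b hb)) hL0).trans ?_
    rw [add_sub_add_left_eq_sub, add_sub_add_left_eq_sub, ← sub_smul, ← sub_smul, norm_smul,
      norm_smul, Real.norm_eq_abs]
    have := hN t ht
    have h : L * (|a - b| * ‖v t‖) ≤ L * (|a - b| * N) := by gcongr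
    linarith
  have hderiv : ∀ t ∈ Icc 0 T,
      HasDerivAt (fun a : ℝ => hfun F (x t + a • v t) (x' t + a • v' t) t ^ p)
        (p * (hfun F (x t) (x' t) t ^ (p - 1) *
          ((inner ℝ (psiStar F ψ₀ (x t) (x' t) t) (v' t) : ℝ) -
            (inner ℝ (sGrad (x t) t (psiStar F ψ₀ (x t) (x' t) t)) (v t) : ℝ)))) 0 := by
    intro t ht
    rcases (hfun_nonneg (F := F) (x t) (x' t) t).eq_or_lt with h0 | hpos
    · rw [← h0, Real.zero_rpow (by linarith), zero_mul, mul_zero]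
      refine hasDerivAt_rpow_of_abs_le (C := ‖v' t‖ + L * N) hp ?_
      filter_upwards [Metric.ball_mem_nhds (0 : ℝ) one_pos] with a ha
      have h := hlip t ht a ha 0 (Metric.mem_ball_self one_pos)
      simpa [← h0] using h
    · have h := (hasDerivAt_hfun_of_pos hFne hFcomp hs hsG hsGc hψ₀ ht (v t) (v' t)
        hpos).rpow_const (p := p) (Or.inr hp.le)
      simp only [zero_smul, add_zero] at h
      convert h using 1
      ring
  set H : ℝ → ℝ := fun t => hfun F (x t) (x' t) t + (‖v' t‖ + L * N) with hH
  have hHLp : MemLp H (ENNReal.ofReal p) (muT T) :=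
    (memLp_hfun hT hs hx).add (hv.2.2.norm.add (memLp_const (L * N)))
  have hHnn : ∀ t, 0 ≤ H t := fun t => add_nonneg (hfun_nonneg _ _ _) (by positivity)
  have hHint : Integrable (fun t => p * H t ^ p) (muT T) :=
    (integrable_rpow_of_memLp hp hHnn hHLp).const_mul p
  have hint : ∀ a : ℝ, Integrable
      (fun t => hfun F (x t + a • v t) (x' t + a • v' t) t ^ p) (muT T) := fun a =>
    integrable_rpow_of_memLp hp (fun t => hfun_nonneg _ _ _) (memLp_hfun hT hs (hx.add_smul hT hv a))
  have hmeas := fun a => (hint a).aestronglyMeasurable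
  refine (hasDerivAt_integral_of_dominated_loc_of_lip (bound := fun t => p * H t ^ p)
    (Metric.ball_mem_nhds (0 : ℝ) one_pos) (Eventually.of_forall hmeas) (hint 0) ?_ ?_ hHint ?_).2
  · refine aestronglyMeasurable_of_tendsto_ae (𝓝[≠] (0 : ℝ))
      (f := fun a t => slope (fun a : ℝ => hfun F (x t + a • v t) (x' t + a • v' t) t ^ p) 0 a)
      (fun a => ?_) ?_
    · simp only [slope_def_module]
      exact ((hmeas a).sub (hmeas 0)).const_smul (a - 0)⁻¹
    · filter_upwards [ae_muT_mem] with t ht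
      exact hasDerivAt_iff_tendsto_slope.1 (hderiv t ht)
  · filter_upwards [ae_muT_mem] with t ht
    have hK : 0 ≤ ‖v' t‖ + L * N := by positivity
    have hle : ∀ a ∈ Metric.ball (0 : ℝ) 1,
        hfun F (x t + a • v t) (x' t + a • v' t) t ∈ Icc 0 (H t) := by
      intro a ha
      refine ⟨hfun_nonneg _ _ _, ?_⟩
      have h := (abs_le.1 (hlip t ht a ha 0 (Metric.mem_ball_self one_pos))).2
      simp only [zero_smul, add_zero, sub_zero] at h
      rw [mem_ball_zero_iff, Real.norm_eq_abs] at ha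
      have h' : (‖v' t‖ + L * N) * |a| ≤ ‖v' t‖ + L * N := mul_le_of_le_one_right hK ha.le
      simp only [hH]
      linarith
    refine LipschitzOnWith.of_dist_le_mul fun a ha b hb => ?_
    have hb0 : 0 ≤ p * H t ^ p := mul_nonneg (by linarith) (Real.rpow_nonneg (hHnn t) p)
    rw [Real.coe_nnabs, abs_of_nonneg hb0, Real.dist_eq, Real.dist_eq]
    have hKH : ‖v' t‖ + L * N ≤ H t := by
      simp only [hH]
      linarith [hfun_nonneg (F := F) (x t) (x' t) t]
    have hpw : H t ^ (p - 1) * H t = H t ^ p := by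
      rw [← Real.rpow_add_one' (hHnn t) (by linarith), sub_add_cancel]
    have hc : 0 ≤ p * H t ^ (p - 1) := mul_nonneg (by linarith) (Real.rpow_nonneg (hHnn t) _)
    calc _ ≤ p * H t ^ (p - 1) * |hfun F (x t + a • v t) (x' t + a • v' t) t -
            hfun F (x t + b • v t) (x' t + b • v' t) t| :=
          abs_rpow_sub_rpow_le hp (hle a ha) (hle b hb)
      _ ≤ p * H t ^ (p - 1) * ((‖v' t‖ + L * N) * |a - b|) := by
          gcongr; exact hlip t ht a ha b hb
      _ ≤ p * H t ^ (p - 1) * (H t * |a - b|) := by gcongr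
      _ = p * H t ^ p * |a - b| := by rw [← hpw]; ring
  · filter_upwards [ae_muT_mem] with t ht
    exact hderiv t ht

end Penalty

/-- Proposition 4.1: if the multifunction `F` is continuous with nonempty compact convex values,
its support function is differentiable in `x` with continuous gradient, then the penalty term
`φ(x) = ‖h(x(·),ẋ(·),·)‖_p` is correctly defined and finite on `W^{1,p}_d(0,T)`, and it is
Gâteaux differentiable at every `x` with `φ(x) > 0`, with the derivative
`φ'(x)[v] = φ(x)^{1−p} ∫₀^T h^{p−1} (⟨ψ*(x,t), v̇(t)⟩ − ⟨∇_x s(F(x(t),t),ψ*(x,t)), v(t)⟩) dt`. -/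
theorem penalty_term_gateaux_differentiable {d : ℕ} (T p : ℝ) (hT : 0 < T) (hp : 1 < p)
    (F : Vec d → ℝ → Set (Vec d))
    (hFne : ∀ (x : Vec d) (t : ℝ), (F x t).Nonempty)
    (hFcomp : ∀ (x : Vec d) (t : ℝ), IsCompact (F x t))
    (hFconv : ∀ (x : Vec d) (t : ℝ), Convex ℝ (F x t))
    -- continuity of the multifunction (w.r.t. the Hausdorff distance)
    (hFcont : Continuous (fun w : Vec d × ℝ =>
      (⟨⟨F w.1 w.2, hFcomp w.1 w.2⟩, hFne w.1 w.2⟩ : TopologicalSpace.NonemptyCompacts (Vec d))))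
    -- differentiability of the support function in `x`, with continuous gradient
    (sGrad : Vec d → ℝ → Vec d → Vec d)
    (hsG : ∀ (t : ℝ), t ∈ Set.Icc 0 T → ∀ ψ ∈ Metric.sphere (0 : Vec d) 1, ∀ x : Vec d,
      HasGradientAt (fun a => suppF F a t ψ) (sGrad x t ψ) x)
    (hsGc : ContinuousOn (fun w : Vec d × ℝ × Vec d => sGrad w.1 w.2.1 w.2.2)
      (Set.univ ×ˢ Set.Icc 0 T ×ˢ Metric.sphere (0 : Vec d) 1))
    (ψ₀ : Vec d) (hψ₀ : ψ₀ ∈ Metric.sphere (0 : Vec d) 1) :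
    -- φ is correctly defined and finite on `W^{1,p}_d(0,T)` ...
    (∀ x x' : ℝ → Vec d, InW T p x x' →
      AEStronglyMeasurable (fun t => hfun F (x t) (x' t) t) (muT T) ∧
      phiDI T p F x x' ≠ ⊤) ∧
    -- ... and Gâteaux differentiable wherever `φ(x) > 0`, with the stated derivative
    (∀ x x' : ℝ → Vec d, InW T p x x' → 0 < phiDI T p F x x' →
      ∀ v v' : ℝ → Vec d, InW T p v v' →
        Filter.Tendsto (fun α : ℝ =>
            ((phiDI T p F (fun t => x t + α • v t) (fun t => x' t + α • v' t)).toReal -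
              (phiDI T p F x x').toReal) / α)
          (nhdsWithin (0 : ℝ) {0}ᶜ)
          (nhds ((phiDI T p F x x').toReal ^ (1 - p) *
            ∫ t in Set.Ioc (0:ℝ) T,
              hfun F (x t) (x' t) t ^ (p - 1) *
                ((inner ℝ (psiStar F ψ₀ (x t) (x' t) t) (v' t) : ℝ) -
                  (inner ℝ (sGrad (x t) t (psiStar F ψ₀ (x t) (x' t) t)) (v t) : ℝ))))) := by
  have hs := continuous_suppF hFne hFcomp hFcont
  refine ⟨fun x x' hx => ⟨(memLp_hfun hT hs hx).aestronglyMeasurable,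
    (memLp_hfun hT hs hx).eLpNorm_ne_top⟩, fun x x' hx hpos v v' hv => ?_⟩
  have hD := hasDerivAt_integral_hfun_rpow hT hp hFne hFcomp hs hsG hsGc hψ₀ hx hv
  have hp0 : p ≠ 0 := by linarith
  set J : ℝ → ℝ := fun a => ∫ t, hfun F (x t + a • v t) (x' t + a • v' t) t ^ p ∂muT T with hJ
  have hφ : ∀ a : ℝ, (phiDI T p F (fun t => x t + a • v t) (fun t => x' t + a • v' t)).toReal =
      J a ^ p⁻¹ := fun a => toReal_phiDI hT hp hs (hx.add_smul hT hv a)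
  have hφ0 : (phiDI T p F x x').toReal = J 0 ^ p⁻¹ := by simpa using hφ 0
  have hJnn : 0 ≤ J 0 := integral_nonneg fun t => Real.rpow_nonneg (hfun_nonneg _ _ _) _
  have hJ0 : J 0 ≠ 0 := by
    intro h0
    have h : 0 < (phiDI T p F x x').toReal :=
      ENNReal.toReal_pos hpos.ne' (memLp_hfun hT hs hx).eLpNorm_ne_top
    rw [hφ0, h0, Real.zero_rpow (inv_ne_zero hp0)] at h
    exact h.false
  have hroot := hasDerivAt_iff_tendsto_slope.1 (hD.rpow_const (p := p⁻¹) (Or.inl hJ0))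
  rw [integral_const_mul] at hroot
  simp only [hφ, hφ0]
  have hexp : (J 0 ^ p⁻¹) ^ (1 - p) = J 0 ^ (p⁻¹ - 1) := by
    rw [← Real.rpow_mul hJnn]
    congr 1
    field_simp
  rw [hexp]
  convert hroot using 2
  · rw [slope_def_field, sub_zero]
  · simp only [muT]
    field_simp
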